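/- Let a, b > 0 satisfy the nine inequalities 2a + b ≥ 1, 3a + 4b ≥ 2, 9a + 11b ≥ 6, a + 5b ≥ 1, 4a + 9b ≥ 3, 10a + 16b ≥ 7, 13a + 20b ≥ 8, 5a + 14b ≥ 4, a + (3/2)b ≥ 2/3. Let G be a graph with no triangle adjacent to a 4-cycle such that α(G) < |V(G)| − (a|V(G)| + b|E(G)| + bλ(G)), and suppose every graph G' with fewer vertices than G and no triangle adjacent to a 4-cycle satisfies α(G') ≥ |V(G')| − (a|V(G')| + b|E(G')| + bλ(G')). Then G contains no vertex of degree two that belongs to a triangle of G. -/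

import Mathlib

namespace Paper

/-- `s` is an independent set in the simple graph `G`. -/
def IsIndepSet {V : Type} (G : SimpleGraph V) (s : Finset V) : Prop :=
  ∀ v ∈ s, ∀ w ∈ s, ¬ G.Adj v w

/-- The independence number `α(G)`: the size of a largest independent set. -/
noncomputable def indepNum {V : Type} (G : SimpleGraph V) : ℕ :=
  sSup {n | ∃ s : Finset V, IsIndepSet G s ∧ s.card = n}

/-- The number of edges `|E(G)|`. -/
noncomputable def numEdges {V : Type} (G : SimpleGraph V) : ℕ :=
  Nat.card G.edgeSet

/-- The degree of a vertex. -/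
noncomputable def deg {V : Type} (G : SimpleGraph V) (v : V) : ℕ :=
  Nat.card (G.neighborSet v)

/-- `G` contains a triangle sharing a common edge with a 4-cycle:
the triangle `u v w` and the 4-cycle `u v x y` share the edge `u v`. -/
def HasTriangleAdjC4 {V : Type} (G : SimpleGraph V) : Prop :=
  ∃ u v w x y : V, G.Adj u v ∧ G.Adj v w ∧ G.Adj w u ∧
    G.Adj v x ∧ G.Adj x y ∧ G.Adj y u ∧ u ≠ x ∧ v ≠ y

/-- `G` contains two triangles sharing a common edge:
the triangles `u v w` and `u v x` share the edge `u v`. -/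
def HasAdjTriangles {V : Type} (G : SimpleGraph V) : Prop :=
  ∃ u v w x : V, G.Adj u v ∧ G.Adj v w ∧ G.Adj w u ∧
    G.Adj v x ∧ G.Adj x u ∧ w ≠ x

/-- `G` contains a triangle sharing a common edge with a 5-cycle:
the triangle `u v w` and the 5-cycle `u v x y z` share the edge `u v`. -/
def HasTriangleAdjC5 {V : Type} (G : SimpleGraph V) : Prop :=
  ∃ u v w x y z : V, G.Adj u v ∧ G.Adj v w ∧ G.Adj w u ∧
    G.Adj v x ∧ G.Adj x y ∧ G.Adj y z ∧ G.Adj z u ∧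
    u ≠ x ∧ u ≠ y ∧ v ≠ y ∧ v ≠ z ∧ x ≠ z

/-- The 2-chain of triangles: two disjoint triangles `{0,1,2}` and `{3,4,5}`
joined by the single edge `{2,3}` (6 vertices, 7 edges). -/
def chainGraph : SimpleGraph (Fin 6) :=
  SimpleGraph.fromRel (fun i j =>
    (i.val, j.val) ∈ [(0,1), (0,2), (1,2), (3,4), (3,5), (4,5), (2,3)])

/-- A connected component is difficult if it is a triangle or a 2-chain of triangles. -/
def IsDifficult {V : Type} (G : SimpleGraph V) (c : G.ConnectedComponent) : Prop :=
  Nonempty (SimpleGraph.induce c.supp G ≃g (⊤ : SimpleGraph (Fin 3))) ∨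
  Nonempty (SimpleGraph.induce c.supp G ≃g chainGraph)

/-- `λ(G)`: the number of difficult components of `G`. -/
noncomputable def lambda {V : Type} (G : SimpleGraph V) : ℕ :=
  Nat.card {c : G.ConnectedComponent // IsDifficult G c}

/-- `Φ(S)`: the number of edges of `G` with exactly one endpoint in `S`. -/
noncomputable def phi {V : Type} (G : SimpleGraph V) (S : Set V) : ℕ :=
  Nat.card {e : Sym2 V | e ∈ G.edgeSet ∧ ∃ x ∈ S, ∃ y, y ∉ S ∧ e = s(x, y)}

open Classical in
/-- The number of ordered pairs `(x, y) ∈ A × B` of adjacent vertices. -/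
noncomputable def adjCount {V : Type} (G : SimpleGraph V) (A B : Finset V) : ℕ :=
  ∑ x ∈ A, ∑ y ∈ B, if G.Adj x y then 1 else 0

lemma adjCount_comm {V : Type} (G : SimpleGraph V) (A B : Finset V) :
    adjCount G A B = adjCount G B A := by
  classical
  unfold adjCount
  rw [Finset.sum_comm]
  exact Finset.sum_congr rfl fun y _ => Finset.sum_congr rfl fun x _ =>
    if_congr (G.adj_comm x y) rfl rfl

open Classical in
lemma adjCount_eq_card {V : Type} (G : SimpleGraph V) (A B : Finset V) :
    adjCount G A B = ((A ×ˢ B).filter fun p => G.Adj p.1 p.2).card := by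
  rw [adjCount, Finset.card_filter, Finset.sum_product]

lemma adjCount_union_left {V : Type} [DecidableEq V] (G : SimpleGraph V) {A B : Finset V}
    (C : Finset V) (h : Disjoint A B) :
    adjCount G (A ∪ B) C = adjCount G A C + adjCount G B C := by
  rw [adjCount, Finset.sum_union h, adjCount, adjCount]

lemma adjCount_union_right {V : Type} [DecidableEq V] (G : SimpleGraph V) (C : Finset V)
    {A B : Finset V} (h : Disjoint A B) :
    adjCount G C (A ∪ B) = adjCount G C A + adjCount G C B := by
  rw [adjCount_comm, adjCount_union_left G C h, adjCount_comm G A, adjCount_comm G B]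

lemma adjCount_union_self {V : Type} [DecidableEq V] (G : SimpleGraph V) {A B : Finset V}
    (h : Disjoint A B) :
    adjCount G (A ∪ B) (A ∪ B) = adjCount G A A + adjCount G B B + 2 * adjCount G A B := by
  rw [adjCount_union_left G _ h, adjCount_union_right G _ h, adjCount_union_right G _ h,
    adjCount_comm G B A]
  ring

lemma adjCount_pos {V : Type} (G : SimpleGraph V) {A B : Finset V} {x y : V}
    (hx : x ∈ A) (hy : y ∈ B) (h : G.Adj x y) : 0 < adjCount G A B := by
  classical
  rw [adjCount_eq_card, Finset.card_pos]
  exact ⟨(x, y), by simp [hx, hy, h]⟩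

lemma adjCount_map {V W : Type} {H : SimpleGraph W} {G : SimpleGraph V} (f : H ↪g G)
    (A B : Finset W) :
    adjCount G (A.map f.toEmbedding) (B.map f.toEmbedding) = adjCount H A B := by
  classical
  simp only [adjCount, Finset.sum_map]
  exact Finset.sum_congr rfl fun x _ => Finset.sum_congr rfl fun y _ =>
    if_congr f.map_adj_iff rfl rfl

lemma two_mul_numEdges {V : Type} [Fintype V] (G : SimpleGraph V) :
    2 * numEdges G = adjCount G Finset.univ Finset.univ := by
  classical
  rw [numEdges, Nat.card_eq_fintype_card, ← SimpleGraph.edgeFinset_card,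
    ← SimpleGraph.sum_degrees_eq_twice_card_edges, adjCount]
  refine Finset.sum_congr rfl fun x _ => ?_
  rw [← SimpleGraph.card_neighborFinset_eq_degree, SimpleGraph.neighborFinset_eq_filter,
    Finset.card_filter]

lemma map_induce_compl_univ {V : Type} [Fintype V] [DecidableEq V] (G : SimpleGraph V)
    (S : Finset V) [Fintype ↥((S : Set V)ᶜ)] :
    (Finset.univ : Finset ↥((S : Set V)ᶜ)).map
      (SimpleGraph.Embedding.induce (G := G) ((S : Set V)ᶜ)).toEmbedding = Sᶜ := by
  ext x
  simp [SimpleGraph.Embedding.induce]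

lemma two_mul_numEdges_eq_induce_compl {V : Type} [Fintype V] [DecidableEq V]
    (G : SimpleGraph V) (S : Finset V) :
    2 * numEdges G = adjCount G S S + 2 * numEdges (G.induce (S : Set V)ᶜ)
      + 2 * adjCount G S Sᶜ := by
  classical
  rw [two_mul_numEdges, two_mul_numEdges, ← adjCount_map (SimpleGraph.Embedding.induce _),
    map_induce_compl_univ, ← Finset.union_compl S, adjCount_union_self G disjoint_compl_right]

lemma card_le_indepNum {V : Type} [Fintype V] {G : SimpleGraph V} {s : Finset V}
    (hs : IsIndepSet G s) : s.card ≤ indepNum G :=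
  le_csSup ⟨Fintype.card V, by rintro _ ⟨t, -, rfl⟩; exact t.card_le_univ⟩ ⟨s, hs, rfl⟩

lemma exists_isIndepSet_card_eq {V : Type} [Fintype V] (G : SimpleGraph V) :
    ∃ s : Finset V, IsIndepSet G s ∧ s.card = indepNum G :=
  Nat.sSup_mem (s := {n | ∃ s : Finset V, IsIndepSet G s ∧ s.card = n})
    ⟨0, ∅, by simp [IsIndepSet], rfl⟩
    ⟨Fintype.card V, by rintro _ ⟨t, -, rfl⟩; exact t.card_le_univ⟩

lemma indepNum_induce_compl_add_card_le {V : Type} [Fintype V] {G : SimpleGraph V}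
    {S I : Finset V} (hIS : I ⊆ S) (hI : IsIndepSet G I)
    (hN : ∀ x ∈ I, ∀ y, G.Adj x y → y ∈ S) :
    indepNum (G.induce (S : Set V)ᶜ) + I.card ≤ indepNum G := by
  classical
  obtain ⟨s, hs, hcard⟩ := exists_isIndepSet_card_eq (G.induce (S : Set V)ᶜ)
  have hdisj : Disjoint (s.map (Function.Embedding.subtype _)) I := by
    rw [Finset.disjoint_left]
    intro x hx hxI
    obtain ⟨y, -, rfl⟩ := Finset.mem_map.1 hx
    exact y.2 (hIS hxI)
  rw [← hcard, ← Finset.card_map (Function.Embedding.subtype _),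
    ← Finset.card_union_of_disjoint hdisj]
  apply card_le_indepNum
  intro x hx y hy hxy
  rcases Finset.mem_union.1 hx with hx | hx <;> rcases Finset.mem_union.1 hy with hy | hy
  · obtain ⟨x', hx', rfl⟩ := Finset.mem_map.1 hx
    obtain ⟨y', hy', rfl⟩ := Finset.mem_map.1 hy
    exact hs x' hx' y' hy' hxy
  · obtain ⟨x, hx, rfl⟩ := Finset.mem_map.1 hx
    exact x.2 (hN y hy _ hxy.symm)
  · obtain ⟨y, hy, rfl⟩ := Finset.mem_map.1 hy
    exact y.2 (hN x hx _ hxy)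
  · exact hI x hx y hy hxy

lemma HasTriangleAdjC4.map {V W : Type} {H : SimpleGraph W} {G : SimpleGraph V} (f : H ↪g G)
    (h : HasTriangleAdjC4 H) : HasTriangleAdjC4 G := by
  obtain ⟨u, v, w, x, y, h1, h2, h3, h4, h5, h6, h7, h8⟩ := h
  exact ⟨f u, f v, f w, f x, f y, f.map_adj_iff.2 h1, f.map_adj_iff.2 h2, f.map_adj_iff.2 h3,
    f.map_adj_iff.2 h4, f.map_adj_iff.2 h5, f.map_adj_iff.2 h6, f.injective.ne h7,
    f.injective.ne h8⟩

lemma mem_of_reachable {V : Type} {G : SimpleGraph V} {D : Set V}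
    (hD : ∀ x ∈ D, ∀ y, G.Adj x y → y ∈ D) {x y : V} (hx : x ∈ D) (h : G.Reachable x y) :
    y ∈ D := by
  rw [SimpleGraph.reachable_iff_reflTransGen] at h
  induction h with
  | refl => exact hx
  | tail _ hbc ih => exact hD _ ih _ hbc

/-- A connected induced subgraph with no edge leaving it is a component. -/
lemma exists_component_of_embedding {V W : Type} {H : SimpleGraph W} {G : SimpleGraph V}
    (f : H ↪g G) (hH : H.Connected)
    (hf : ∀ x ∈ Set.range f, ∀ y, G.Adj x y → y ∈ Set.range f) :
    ∃ c : G.ConnectedComponent, c.supp = Set.range f ∧ Nonempty (G.induce c.supp ≃g H) := by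
  obtain ⟨w⟩ := hH.nonempty
  have hsupp : (G.connectedComponentMk (f w)).supp = Set.range f := by
    ext y
    rw [SimpleGraph.ConnectedComponent.mem_supp_iff, SimpleGraph.ConnectedComponent.eq]
    constructor
    · exact fun h => mem_of_reachable hf ⟨w, rfl⟩ h.symm
    · rintro ⟨z, rfl⟩
      exact (hH.preconnected z w).map f.toHom
  refine ⟨_, hsupp, ?_⟩
  rw [hsupp]
  exact ⟨f.isoInduceRange.symm⟩

/-- The component `c` of `G - S` is joined to `S` by an edge of `G`. -/
def Touches {V : Type} (G : SimpleGraph V) (S : Finset V)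
    (c : (G.induce (S : Set V)ᶜ).ConnectedComponent) : Prop :=
  ∃ x ∈ c.supp, ∃ s ∈ S, G.Adj s x

lemma mem_image_supp_of_adj {V : Type} {G : SimpleGraph V} {S : Finset V}
    {c : (G.induce (S : Set V)ᶜ).ConnectedComponent} {x y : V}
    (hx : x ∈ Subtype.val '' c.supp) (hxy : G.Adj x y) (hy : y ∉ S) :
    y ∈ Subtype.val '' c.supp := by
  obtain ⟨x, hx, rfl⟩ := hx
  refine ⟨⟨y, hy⟩, ?_, rfl⟩
  rw [SimpleGraph.ConnectedComponent.mem_supp_iff] at hx ⊢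
  rw [← hx, SimpleGraph.ConnectedComponent.eq]
  exact SimpleGraph.Adj.reachable (G := G.induce (S : Set V)ᶜ) hxy.symm

lemma exists_component_of_not_touches {V : Type} {G : SimpleGraph V} {S : Finset V}
    {c : (G.induce (S : Set V)ᶜ).ConnectedComponent} (hc : ¬ Touches G S c) :
    ∃ c' : G.ConnectedComponent, c'.supp = Subtype.val '' c.supp ∧
      Nonempty (G.induce c'.supp ≃g (G.induce (S : Set V)ᶜ).induce c.supp) := by
  have hrange : Set.range ((SimpleGraph.Embedding.induce (G := G) ((S : Set V)ᶜ)).comp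
      (SimpleGraph.Embedding.induce c.supp)) = Subtype.val '' c.supp := by
    rw [SimpleGraph.Embedding.coe_comp, Set.range_comp]
    exact congrArg _ Subtype.range_coe
  rw [← hrange]
  refine exists_component_of_embedding _ c.connected_toSimpleGraph ?_
  rw [hrange]
  intro x hx y hxy
  by_cases hy : y ∈ S
  · obtain ⟨x, hx, rfl⟩ := hx
    exact absurd ⟨x, hx, y, hy, hxy.symm⟩ hc
  · exact mem_image_supp_of_adj hx hxy hy

lemma lambda_eq_ncard {V : Type} (G : SimpleGraph V) :
    lambda G = {c : G.ConnectedComponent | IsDifficult G c}.ncard := rfl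

/-- Every difficult component of `G - S` is joined to `S` or is a difficult component of `G`
that misses `S`. -/
lemma lambda_induce_compl_add_le {V : Type} [Fintype V] (G : SimpleGraph V) (S : Finset V) :
    lambda (G.induce (S : Set V)ᶜ) +
        {c : G.ConnectedComponent | IsDifficult G c ∧ ∃ x ∈ c.supp, x ∈ S}.ncard ≤
      {c | IsDifficult (G.induce (S : Set V)ᶜ) c ∧ Touches G S c}.ncard + lambda G := by
  have hle : {c | IsDifficult (G.induce (S : Set V)ᶜ) c ∧ ¬ Touches G S c}.ncard ≤
      {c : G.ConnectedComponent | IsDifficult G c ∧ ¬ ∃ x ∈ c.supp, x ∈ S}.ncard := by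
    have hex : ∀ c : (G.induce (S : Set V)ᶜ).ConnectedComponent, ∃ c' : G.ConnectedComponent,
        ¬ Touches G S c → c'.supp = Subtype.val '' c.supp ∧
          Nonempty (G.induce c'.supp ≃g (G.induce (S : Set V)ᶜ).induce c.supp) := by
      intro c
      by_cases hc : Touches G S c
      · exact ⟨c.map (SimpleGraph.Embedding.induce _).toHom, absurd hc⟩
      · exact (exists_component_of_not_touches hc).imp fun _ h _ => h
    choose g hg' using hex
    have hg := fun c hc => (hg' c hc).1
    have hiso := fun c hc => (hg' c hc).2
    refine Set.ncard_le_ncard_of_injOn g ?_ ?_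
    · rintro c ⟨hd, hc⟩
      obtain ⟨e⟩ := hiso c hc
      refine ⟨hd.imp (fun ⟨i⟩ => ⟨i.comp e⟩) (fun ⟨i⟩ => ⟨i.comp e⟩), ?_⟩
      rw [hg c hc]
      rintro ⟨_, ⟨y, -, rfl⟩, hy⟩
      exact y.2 hy
    · rintro c ⟨-, hc⟩ d ⟨-, hd⟩ h
      apply SimpleGraph.ConnectedComponent.supp_injective
      apply Set.image_injective.2 Subtype.val_injective
      rw [← hg c hc, ← hg d hd, h]
  have h1 := Set.ncard_inter_add_ncard_sdiff_eq_ncard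
    {c | IsDifficult (G.induce (S : Set V)ᶜ) c} {c | Touches G S c}
  have h2 := Set.ncard_inter_add_ncard_sdiff_eq_ncard
    {c : G.ConnectedComponent | IsDifficult G c} {c | ∃ x ∈ c.supp, x ∈ S}
  rw [lambda_eq_ncard, lambda_eq_ncard, ← h1, ← h2]
  simp only [Set.inter_def, Set.sdiff_eq, Set.mem_ofPred_eq, Set.mem_compl_iff] at hle ⊢
  omega

lemma ncard_touches_le {V : Type} [Fintype V] [DecidableEq V] (G : SimpleGraph V)
    (S : Finset V) :
    {c | IsDifficult (G.induce (S : Set V)ᶜ) c ∧ Touches G S c}.ncard ≤ adjCount G S Sᶜ := by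
  classical
  rw [adjCount_eq_card, ← Set.ncard_coe_finset]
  have hex : ∀ c : (G.induce (S : Set V)ᶜ).ConnectedComponent, ∃ p : V × V,
      Touches G S c → p.1 ∈ S ∧ G.Adj p.1 p.2 ∧ ∃ x ∈ c.supp, x.1 = p.2 := by
    intro c
    by_cases hc : Touches G S c
    · obtain ⟨x, hx, s, hs, h⟩ := hc
      exact ⟨(s, x), fun _ => ⟨hs, h, x, hx, rfl⟩⟩
    · obtain ⟨x, -⟩ := c.nonempty_supp
      exact ⟨(x, x), fun h => absurd h hc⟩
  choose g hg using hex
  refine Set.ncard_le_ncard_of_injOn g ?_ ?_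
  · rintro c ⟨-, hc⟩
    obtain ⟨hs, hadj, x, -, hx⟩ := hg c hc
    have := x.2
    simp_all
  · rintro c ⟨-, hc⟩ d ⟨-, hd⟩ h
    obtain ⟨-, -, x, hxc, hx⟩ := hg c hc
    obtain ⟨-, -, y, hyd, hy⟩ := hg d hd
    have hxy : x = y := Subtype.ext (by rw [hx, hy, h])
    rw [← (SimpleGraph.ConnectedComponent.mem_supp_iff _ _).1 hxc,
      ← (SimpleGraph.ConnectedComponent.mem_supp_iff _ _).1 hyd, hxy]

/-- `D` is a union of components of `G - T` joined to `T`, with an independent set `I` and with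
as many vertices and at least as many edges as needed to extend `T` by `r` triangles. -/
structure IsAttached {V : Type} (G : SimpleGraph V) (T D I : Finset V) (r : ℕ) : Prop where
  disjoint : Disjoint T D
  closed : ∀ x ∈ D, ∀ y, G.Adj x y → y ∈ T ∨ y ∈ D
  card_eq : D.card = 3 * r
  le_adjCount : 8 * r ≤ adjCount G D D + 2 * adjCount G T D
  subset : I ⊆ D
  indep : IsIndepSet G I
  card_indep : I.card = r

lemma IsAttached.union {V : Type} [DecidableEq V] {G : SimpleGraph V}
    {T D₁ D₂ I₁ I₂ : Finset V} {r₁ r₂ : ℕ} (h₁ : IsAttached G T D₁ I₁ r₁)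
    (h₂ : IsAttached G T D₂ I₂ r₂) (hD : Disjoint D₁ D₂) :
    IsAttached G T (D₁ ∪ D₂) (I₁ ∪ I₂) (r₁ + r₂) where
  disjoint := Finset.disjoint_union_right.2 ⟨h₁.disjoint, h₂.disjoint⟩
  closed x hx y hxy := by
    rcases Finset.mem_union.1 hx with hx | hx
    · exact (h₁.closed x hx y hxy).imp_right fun h => Finset.mem_union_left _ h
    · exact (h₂.closed x hx y hxy).imp_right fun h => Finset.mem_union_right _ h
  card_eq := by
    rw [Finset.card_union_of_disjoint hD, h₁.card_eq, h₂.card_eq]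
    ring
  le_adjCount := by
    have e₁ := h₁.le_adjCount
    have e₂ := h₂.le_adjCount
    rw [adjCount_union_self G hD, adjCount_union_right G T hD]
    omega
  subset := Finset.union_subset_union h₁.subset h₂.subset
  indep := by
    have key : ∀ x ∈ I₁, ∀ y ∈ I₂, ¬ G.Adj x y := by
      intro x hx y hy hxy
      rcases h₁.closed x (h₁.subset hx) y hxy with h | h
      · exact Finset.disjoint_left.1 h₂.disjoint h (h₂.subset hy)
      · exact Finset.disjoint_left.1 hD h (h₂.subset hy)
    intro x hx y hy hxy
    rcases Finset.mem_union.1 hx with hx | hx <;> rcases Finset.mem_union.1 hy with hy | hy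
    · exact h₁.indep x hx y hy hxy
    · exact key x hx y hy hxy
    · exact key y hy x hx hxy.symm
    · exact h₂.indep x hx y hy hxy
  card_indep := by
    rw [Finset.card_union_of_disjoint (hD.mono h₁.subset h₂.subset), h₁.card_indep,
      h₂.card_indep]

instance : DecidableRel chainGraph.Adj := fun i j =>
  decidable_of_iff _ (SimpleGraph.fromRel_adj _ i j).symm

lemma chainGraph_connected : chainGraph.Connected := by decide

lemma adjCount_chainGraph : adjCount chainGraph Finset.univ Finset.univ = 14 := by
  have h : ∑ x, ∑ y, (if chainGraph.Adj x y then 1 else 0) = 14 := by decide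
  rw [← h, adjCount]
  congr!

lemma adjCount_top_fin_three :
    adjCount (⊤ : SimpleGraph (Fin 3)) Finset.univ Finset.univ = 6 := by
  have h : ∑ x, ∑ y, (if (⊤ : SimpleGraph (Fin 3)).Adj x y then 1 else 0) = 6 := by decide
  rw [← h, adjCount]
  congr!

lemma exists_isAttached_of_iso {V : Type} [Fintype V] {G : SimpleGraph V} {T : Finset V}
    {c : (G.induce (T : Set V)ᶜ).ConnectedComponent} (hc : Touches G T c) {n r : ℕ}
    {H : SimpleGraph (Fin n)} (e : (G.induce (T : Set V)ᶜ).induce c.supp ≃g H)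
    (hn : n = 3 * r) (hH : 8 * r ≤ adjCount H Finset.univ Finset.univ + 2)
    {J : Finset (Fin n)} (hJ : IsIndepSet H J) (hJr : J.card = r) :
    ∃ D I : Finset V, (D : Set V) = Subtype.val '' c.supp ∧ IsAttached G T D I r := by
  set f : H ↪g G := (SimpleGraph.Embedding.induce _).comp
    ((SimpleGraph.Embedding.induce c.supp).comp e.symm.toEmbedding) with hf
  have hrange : Set.range f = Subtype.val '' c.supp := by
    rw [hf, SimpleGraph.Embedding.coe_comp, Set.range_comp, SimpleGraph.Embedding.coe_comp,
      Set.range_comp]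
    change Subtype.val '' (Subtype.val '' (Set.range e.symm)) = _
    rw [Set.range_eq_univ.2 e.symm.surjective, Set.image_univ, Subtype.range_coe]
  have hD : ((Finset.univ.map f.toEmbedding : Finset V) : Set V) = Subtype.val '' c.supp := by
    rw [← hrange]
    simp
  have hmem : ∀ x, x ∈ Finset.univ.map f.toEmbedding ↔ x ∈ Subtype.val '' c.supp := by
    intro x
    rw [← hD, Finset.mem_coe]
  refine ⟨Finset.univ.map f.toEmbedding, J.map f.toEmbedding, hD, ?_, ?_, ?_, ?_, ?_, ?_, ?_⟩
  · rw [Finset.disjoint_right]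
    intro x hx
    obtain ⟨y, -, rfl⟩ := (hmem x).1 hx
    exact y.2
  · intro x hx y hxy
    rw [hmem] at hx ⊢
    exact or_iff_not_imp_left.2 (mem_image_supp_of_adj hx hxy)
  · simp [hn]
  · obtain ⟨x, hx, s, hs, hadj⟩ := hc
    have := adjCount_pos G hs ((hmem x).2 ⟨x, hx, rfl⟩) hadj
    rw [adjCount_map]
    omega
  · exact Finset.map_subset_map.2 (Finset.subset_univ _)
  · intro x hx y hy hxy
    obtain ⟨x', hx', rfl⟩ := Finset.mem_map.1 hx
    obtain ⟨y', hy', rfl⟩ := Finset.mem_map.1 hy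
    exact hJ x' hx' y' hy' (f.map_adj_iff.1 hxy)
  · simp [hJr]

lemma exists_isAttached {V : Type} [Fintype V] {G : SimpleGraph V} {T : Finset V}
    {c : (G.induce (T : Set V)ᶜ).ConnectedComponent} (hc : Touches G T c)
    (hd : IsDifficult (G.induce (T : Set V)ᶜ) c) :
    ∃ (D I : Finset V), (D : Set V) = Subtype.val '' c.supp ∧
      (IsAttached G T D I 2 ∨
        IsAttached G T D I 1 ∧ ∀ x ∈ D, ∀ y ∈ D, x ≠ y → G.Adj x y) := by
  rcases hd with ⟨⟨e⟩⟩ | ⟨⟨e⟩⟩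
  · obtain ⟨D, I, hD, h⟩ := exists_isAttached_of_iso hc e (r := 1) rfl
      (by rw [adjCount_top_fin_three]) (J := {0}) (by simp [IsIndepSet]) rfl
    refine ⟨D, I, hD, Or.inr ⟨h, ?_⟩⟩
    intro x hx y hy hxy
    rw [← Finset.mem_coe, hD] at hx hy
    obtain ⟨x, hx, rfl⟩ := hx
    obtain ⟨y, hy, rfl⟩ := hy
    have : ((G.induce (T : Set V)ᶜ).induce c.supp).Adj ⟨x, hx⟩ ⟨y, hy⟩ := by
      rw [← e.map_adj_iff, SimpleGraph.top_adj]
      intro h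
      exact hxy (congrArg (fun z => z.1.1) (e.injective h))
    exact this
  · obtain ⟨D, I, hD, h⟩ := exists_isAttached_of_iso hc e (r := 2) rfl
      (by rw [adjCount_chainGraph]) (J := {0, 5}) (by unfold IsIndepSet; decide) rfl
    exact ⟨D, I, hD, Or.inl h⟩

lemma exists_triangle_embedding {V : Type} {G : SimpleGraph V} {v u w : V} (hvu : G.Adj v u)
    (huw : G.Adj u w) (hwv : G.Adj w v) :
    ∃ f : (⊤ : SimpleGraph (Fin 3)) ↪g G, Set.range f = {v, u, w} := by
  have hinj : Function.Injective ![v, u, w] := by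
    intro i j
    fin_cases i <;> fin_cases j <;>
      simp [hvu.ne, hvu.ne', huw.ne, huw.ne', hwv.ne, hwv.ne']
  have hadj : ∀ i j, G.Adj (![v, u, w] i) (![v, u, w] j) ↔ (⊤ : SimpleGraph (Fin 3)).Adj i j := by
    intro i j
    fin_cases i <;> fin_cases j <;> simp [hvu, huw, hwv, hvu.symm, huw.symm, hwv.symm]
  refine ⟨⟨⟨_, hinj⟩, hadj _ _⟩, ?_⟩
  change Set.range ![v, u, w] = _
  simp only [Matrix.range_cons, Matrix.range_empty, Set.union_empty, Set.singleton_union]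

lemma exists_chainGraph_embedding {V : Type} {G : SimpleGraph V} {p q s x y z : V}
    (hpq : G.Adj p q) (hps : G.Adj p s) (hqs : G.Adj q s) (hsx : G.Adj s x)
    (hxy : G.Adj x y) (hxz : G.Adj x z) (hyz : G.Adj y z)
    (hpx : ¬ G.Adj p x) (hpy : ¬ G.Adj p y) (hpz : ¬ G.Adj p z)
    (hqx : ¬ G.Adj q x) (hqy : ¬ G.Adj q y) (hqz : ¬ G.Adj q z)
    (hsy : ¬ G.Adj s y) (hsz : ¬ G.Adj s z) :
    ∃ f : chainGraph ↪g G, Set.range f = {p, q, s, x, y, z} := by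
  have npx : p ≠ x := by rintro rfl; exact hqx hpq.symm
  have npy : p ≠ y := by rintro rfl; exact hqy hpq.symm
  have npz : p ≠ z := by rintro rfl; exact hqz hpq.symm
  have nqx : q ≠ x := by rintro rfl; exact hpx hpq
  have nqy : q ≠ y := by rintro rfl; exact hpy hpq
  have nqz : q ≠ z := by rintro rfl; exact hpz hpq
  have nsy : s ≠ y := by rintro rfl; exact hpy hps
  have nsz : s ≠ z := by rintro rfl; exact hpz hps
  have hinj : Function.Injective ![p, q, s, x, y, z] := by
    intro i j
    fin_cases i <;> fin_cases j <;>
      simp [hpq.ne, hpq.ne', hps.ne, hps.ne', hqs.ne, hqs.ne', hsx.ne, hsx.ne', hxy.ne, hxy.ne',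
        hxz.ne, hxz.ne', hyz.ne, hyz.ne', npx, npx.symm, npy, npy.symm, npz, npz.symm, nqx,
        nqx.symm, nqy, nqy.symm, nqz, nqz.symm, nsy, nsy.symm, nsz, nsz.symm]
  have hadj : ∀ i j, G.Adj (![p, q, s, x, y, z] i) (![p, q, s, x, y, z] j) ↔
      chainGraph.Adj i j := by
    intro i j
    fin_cases i <;> fin_cases j <;>
      simp [chainGraph, hpq, hpq.symm, hps, hps.symm, hqs, hqs.symm, hsx, hsx.symm, hxy,
        hxy.symm, hxz, hxz.symm, hyz, hyz.symm, hpx, hpy, hpz, hqx, hqy, hqz, hsy, hsz,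
        G.adj_comm x p, G.adj_comm y p, G.adj_comm z p, G.adj_comm x q, G.adj_comm y q,
        G.adj_comm z q, G.adj_comm y s, G.adj_comm z s]
  refine ⟨⟨⟨_, hinj⟩, hadj _ _⟩, ?_⟩
  change Set.range ![p, q, s, x, y, z] = _
  simp only [Matrix.range_cons, Matrix.range_empty, Set.union_empty, Set.singleton_union]

/-- Bounding a minimum counterexample by deleting `S` and adding `I ⊆ S` to an independent set. -/
lemma lt_of_minimal_counterexample {a b : ℝ} {V : Type} [Fintype V] [DecidableEq V]
    {G : SimpleGraph V} (hG : ¬ HasTriangleAdjC4 G)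
    (hcex : (indepNum G : ℝ) <
      (Nat.card V : ℝ) - (a * Nat.card V + b * numEdges G + b * lambda G))
    (hmin : ∀ (W : Type) [Fintype W] (G' : SimpleGraph W),
      Nat.card W < Nat.card V → ¬ HasTriangleAdjC4 G' →
      (indepNum G' : ℝ) ≥
        (Nat.card W : ℝ) - (a * Nat.card W + b * numEdges G' + b * lambda G'))
    {S I : Finset V} (hS : S.Nonempty) (hIS : I ⊆ S) (hI : IsIndepSet G I)
    (hN : ∀ x ∈ I, ∀ y, G.Adj x y → y ∈ S) :
    a * S.card + b * (adjCount G S S / 2 + adjCount G S Sᶜ) + b * lambda G + I.card <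
      S.card + b * lambda (G.induce (S : Set V)ᶜ) := by
  have hcard : Nat.card ↥((S : Set V)ᶜ) + S.card = Nat.card V := by
    have := Set.ncard_add_ncard_compl (S : Set V)
    rw [Set.ncard_coe_finset] at this
    rw [Nat.card_coe_set_eq]
    omega
  have hpos := hS.card_pos
  have hα := indepNum_induce_compl_add_card_le hIS hI hN
  have hE := two_mul_numEdges_eq_induce_compl G S
  have hm := hmin ↥((S : Set V)ᶜ) (G.induce (S : Set V)ᶜ) (by omega)
    fun h => hG (h.map (SimpleGraph.Embedding.induce _))
  rw [← hcard] at hcex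
  have hα' : (indepNum (G.induce (S : Set V)ᶜ) : ℝ) + I.card ≤ indepNum G := by
    exact_mod_cast hα
  have hE' : (2 : ℝ) * numEdges G = adjCount G S S + 2 * numEdges (G.induce (S : Set V)ᶜ)
      + 2 * adjCount G S Sᶜ := by exact_mod_cast hE
  have hE'' : (numEdges G : ℝ) = adjCount G S S / 2 + numEdges (G.induce (S : Set V)ᶜ)
      + adjCount G S Sᶜ := by linarith
  rw [hE''] at hcex
  push_cast at hcex
  linarith

/-- A difficult induced subgraph on `S` with no edge leaving it lowers `λ` when deleted, up to
the components created by the deletion. -/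
lemma lambda_induce_compl_lt {V : Type} [Fintype V] [DecidableEq V] {G : SimpleGraph V}
    {S : Finset V} {n : ℕ} {H : SimpleGraph (Fin n)} (f : H ↪g G) (hf : Set.range f = S)
    (hH : H.Connected)
    (hd : ∀ c : G.ConnectedComponent, Nonempty (G.induce c.supp ≃g H) → IsDifficult G c)
    (hS : adjCount G S Sᶜ = 0) :
    lambda (G.induce (S : Set V)ᶜ) + 1 ≤ lambda G := by
  obtain ⟨c, hc, hiso⟩ := exists_component_of_embedding f hH <| by
    intro x hx y hxy
    rw [hf] at hx ⊢
    by_contra hy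
    exact (adjCount_pos G hx (Finset.mem_compl.2 hy) hxy).ne' hS
  have hpos : 0 < {c : G.ConnectedComponent | IsDifficult G c ∧ ∃ x ∈ c.supp, x ∈ S}.ncard := by
    rw [Set.ncard_pos]
    obtain ⟨x, hx⟩ := c.nonempty_supp
    exact ⟨c, hd c hiso, x, hx, by rwa [hc, hf] at hx⟩
  have h1 := lambda_induce_compl_add_le G S
  have h2 := ncard_touches_le G S
  omega

/-- A triangle `T = {p, q, s}` with a single edge leaving it, which ends in a triangle `D` that
is a component of `G - T`, forms together with `D` a 2-chain of triangles. -/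
lemma lambda_union_compl_lt {V : Type} [Fintype V] [DecidableEq V] {G : SimpleGraph V}
    {T D I : Finset V} {p q s x : V} (hT : T = {p, q, s}) (hpq : G.Adj p q) (hps : G.Adj p s)
    (hqs : G.Adj q s) (hout : adjCount G T Tᶜ = 1) (hD : IsAttached G T D I 1)
    (hclique : ∀ x ∈ D, ∀ y ∈ D, x ≠ y → G.Adj x y) (hx : x ∈ D) (hsx : G.Adj s x) :
    lambda (G.induce ((T ∪ D : Finset V) : Set V)ᶜ) + 1 ≤ lambda G := by
  have hDT : ∀ y ∈ D, y ∈ Tᶜ := fun y hy =>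
    Finset.mem_compl.2 (Finset.disjoint_right.1 hD.disjoint hy)
  have huniq : ∀ t ∈ T, ∀ y ∈ Tᶜ, G.Adj t y → t = s ∧ y = x := by
    intro t ht y hy hty
    classical
    rw [adjCount_eq_card, Finset.card_eq_one] at hout
    obtain ⟨e, he⟩ := hout
    have h1 : (t, y) ∈ ({e} : Finset (V × V)) := by
      rw [← he]; exact Finset.mem_filter.2 ⟨Finset.mem_product.2 ⟨ht, hy⟩, hty⟩
    have h2 : (s, x) ∈ ({e} : Finset (V × V)) := by
      rw [← he]
      exact Finset.mem_filter.2 ⟨Finset.mem_product.2 ⟨by simp [hT], hDT x hx⟩, hsx⟩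
    rw [Finset.mem_singleton] at h1 h2
    exact Prod.mk.inj (h1.trans h2.symm)
  have hcard : (D.erase x).card = 2 := by
    rw [Finset.card_erase_of_mem hx, hD.card_eq]
  obtain ⟨y, z, hyz, hyzD⟩ := Finset.card_eq_two.1 hcard
  have hDeq : D = {x, y, z} := by rw [← Finset.insert_erase hx, hyzD]
  have hyx : y ≠ x ∧ y ∈ D := Finset.mem_erase.1 (by simp [hyzD])
  have hzx : z ≠ x ∧ z ∈ D := Finset.mem_erase.1 (by simp [hyzD])
  have hpT : p ∈ T := by simp [hT]
  have hqT : q ∈ T := by simp [hT]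
  have hsT : s ∈ T := by simp [hT]
  obtain ⟨f, hf⟩ := exists_chainGraph_embedding hpq hps hqs hsx (hclique x hx y hyx.2 hyx.1.symm)
    (hclique x hx z hzx.2 hzx.1.symm) (hclique y hyx.2 z hzx.2 hyz)
    (fun h => hps.ne (huniq p hpT x (hDT x hx) h).1)
    (fun h => hps.ne (huniq p hpT y (hDT y hyx.2) h).1)
    (fun h => hps.ne (huniq p hpT z (hDT z hzx.2) h).1)
    (fun h => hqs.ne (huniq q hqT x (hDT x hx) h).1)
    (fun h => hqs.ne (huniq q hqT y (hDT y hyx.2) h).1)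
    (fun h => hqs.ne (huniq q hqT z (hDT z hzx.2) h).1)
    (fun h => hyx.1 (huniq s hsT y (hDT y hyx.2) h).2)
    (fun h => hzx.1 (huniq s hsT z (hDT z hzx.2) h).2)
  refine lambda_induce_compl_lt f ?_ chainGraph_connected (fun c => Or.inr) ?_
  · rw [hf, hT, hDeq]
    ext t
    simp only [Finset.coe_union, Finset.coe_insert, Finset.coe_singleton, Set.mem_union,
      Set.mem_insert_iff, Set.mem_singleton_iff]
    tauto
  · by_contra h
    obtain ⟨⟨t, y⟩, hty⟩ := Finset.card_pos.1
      ((Nat.pos_of_ne_zero h).trans_eq (adjCount_eq_card G _ _))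
    simp only [Finset.mem_filter, Finset.mem_product, Finset.mem_union, Finset.mem_compl,
      not_or] at hty
    obtain ⟨⟨ht | ht, hyT, hyD⟩, hadj⟩ := hty
    · exact hyD ((huniq t ht y (Finset.mem_compl.2 hyT) hadj).2 ▸ hx)
    · exact (hD.closed t ht y hadj).elim hyT hyD

/-- Claim 2.5: a minimum counterexample has no degree-2 vertex in a triangle. -/
theorem claim_no_deg_two_in_triangle
(a b : ℝ) (ha : 0 < a) (hb : 0 < b)
    (h1 : 2 * a + b ≥ 1) (h2 : 3 * a + 4 * b ≥ 2) (h3 : 9 * a + 11 * b ≥ 6)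
    (h4 : a + 5 * b ≥ 1) (h5 : 4 * a + 9 * b ≥ 3) (h6 : 10 * a + 16 * b ≥ 7)
    (h7 : 13 * a + 20 * b ≥ 8) (h8 : 5 * a + 14 * b ≥ 4)
    (h9 : a + (3 / 2) * b ≥ 2 / 3)
{V : Type} [Fintype V] (G : SimpleGraph V)
    (hG : ¬ HasTriangleAdjC4 G)
    (hcex : (indepNum G : ℝ) <
      (Nat.card V : ℝ) - (a * Nat.card V + b * numEdges G + b * lambda G))
    (hmin : ∀ (W : Type) [Fintype W] (G' : SimpleGraph W),
      Nat.card W < Nat.card V → ¬ HasTriangleAdjC4 G' →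
      (indepNum G' : ℝ) ≥
        (Nat.card W : ℝ) - (a * Nat.card W + b * numEdges G' + b * lambda G')) :
    ¬ ∃ v u w : V, deg G v = 2 ∧ G.Adj v u ∧ G.Adj u w ∧ G.Adj w v := by
  classical
  rintro ⟨v, u, w, hdeg, hvu, huw, hwv⟩
  set T : Finset V := {v, u, w} with hT
  have hvN : ∀ y, G.Adj v y → y = u ∨ y = w := by
    rw [deg, Nat.card_coe_set_eq] at hdeg
    have hsub : ({u, w} : Set V) ⊆ G.neighborSet v := by
      rintro y (rfl | rfl)
      exacts [hvu, hwv.symm]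
    have heq := Set.eq_of_subset_of_ncard_le hsub (by rw [hdeg, Set.ncard_pair huw.ne])
    intro y hy
    have : y ∈ ({u, w} : Set V) := heq ▸ hy
    simpa using this
  have hvT : v ∈ T := by simp [hT]
  obtain ⟨f, hf⟩ := exists_triangle_embedding hvu huw hwv
  have hfT : Set.range f = T := by simp [hf, hT]
  have hTmap : Finset.univ.map f.toEmbedding = T := by
    rw [← Finset.coe_inj, ← hfT]
    simp
  have hTcard : T.card = 3 := by simp [← hTmap]
  have hTT : adjCount G T T = 6 := by rw [← hTmap, adjCount_map, adjCount_top_fin_three]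
  have key : ∀ (D I : Finset V) (r : ℕ), IsAttached G T D I r →
      a * (3 * (r + 1)) + b * (3 + 4 * r + adjCount G (T ∪ D) (T ∪ D)ᶜ) + b * lambda G + (r + 1) <
        3 * (r + 1) + b * lambda (G.induce ((T ∪ D : Finset V) : Set V)ᶜ) := by
    intro D I r h
    have hvI : v ∉ I := fun hv => Finset.disjoint_left.1 h.disjoint hvT (h.subset hv)
    have hvadj : ∀ y ∈ I, ¬ G.Adj v y := by
      intro y hy hvy
      refine Finset.disjoint_right.1 h.disjoint (h.subset hy) ?_
      rcases hvN y hvy with rfl | rfl <;> simp [hT]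
    have := lt_of_minimal_counterexample hG hcex hmin (S := T ∪ D) (I := insert v I)
      ⟨v, Finset.mem_union_left _ hvT⟩
      (Finset.insert_subset (Finset.mem_union_left _ hvT)
        (h.subset.trans Finset.subset_union_right))
      (by
        intro x hx y hy hxy
        rcases Finset.mem_insert.1 hx with hxv | hxI <;>
          rcases Finset.mem_insert.1 hy with hyv | hyI
        · exact hxy.ne (hxv.trans hyv.symm)
        · exact hvadj y hyI (hxv ▸ hxy)
        · exact hvadj x hxI (hyv ▸ hxy.symm)
        · exact h.indep x hxI y hyI hxy)
      (by
        intro x hx y hxy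
        rcases Finset.mem_insert.1 hx with rfl | hx
        · apply Finset.mem_union_left
          rcases hvN y hxy with rfl | rfl <;> simp [hT]
        · exact Finset.mem_union.2 (h.closed x (h.subset hx) y hxy))
    rw [Finset.card_insert_of_notMem hvI, h.card_indep, Finset.card_union_of_disjoint h.disjoint,
      hTcard, h.card_eq] at this
    have hE : 6 + 8 * r ≤ adjCount G (T ∪ D) (T ∪ D) := by
      have := h.le_adjCount
      rw [adjCount_union_self G h.disjoint, hTT]
      omega
    have hE' : (6 : ℝ) + 8 * r ≤ adjCount G (T ∪ D) (T ∪ D) := by exact_mod_cast hE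
    push_cast at this
    nlinarith
  have no_two : ∀ D I : Finset V, ¬ IsAttached G T D I 2 := by
    intro D I h
    have hlam := lambda_induce_compl_add_le G (T ∪ D)
    have hout := ncard_touches_le G (T ∪ D)
    have hle : (lambda (G.induce ((T ∪ D : Finset V) : Set V)ᶜ) : ℝ) ≤
        adjCount G (T ∪ D) (T ∪ D)ᶜ + lambda G := by
      exact_mod_cast (by omega)
    have := key D I 2 h
    push_cast at this
    nlinarith
  have hsub : {c | IsDifficult (G.induce (T : Set V)ᶜ) c ∧ Touches G T c}.ncard ≤ 1 := by
    rw [Set.ncard_le_one]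
    rintro c ⟨hcd, hct⟩ d ⟨hdd, hdt⟩
    obtain ⟨D₁, I₁, hD₁, h₁ | ⟨h₁, -⟩⟩ := exists_isAttached hct hcd
    · exact absurd h₁ (no_two _ _)
    obtain ⟨D₂, I₂, hD₂, h₂ | ⟨h₂, -⟩⟩ := exists_isAttached hdt hdd
    · exact absurd h₂ (no_two _ _)
    by_contra hcd
    refine no_two _ _ (h₁.union h₂ ?_)
    rw [← Finset.disjoint_coe, hD₁, hD₂]
    exact (Set.disjoint_image_iff Subtype.val_injective).2
      (SimpleGraph.pairwise_disjoint_supp_connectedComponent _ hcd)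
  have hlam := lambda_induce_compl_add_le G T
  have hout := ncard_touches_le G T
  have hlt : adjCount G T Tᶜ + lambda G < lambda (G.induce (T : Set V)ᶜ) + 1 := by
    have h := key ∅ ∅ 0 ⟨by simp, by simp, rfl, by simp, le_rfl, by simp [IsIndepSet], rfl⟩
    rw [Finset.union_empty] at h
    push_cast at h
    have : (adjCount G T Tᶜ + lambda G : ℝ) < lambda (G.induce (T : Set V)ᶜ) + 1 := by
      by_contra! hcon
      nlinarith
    exact_mod_cast this
  have hTout : adjCount G T Tᶜ = 1 := by
    by_contra hne
    have := lambda_induce_compl_lt f hfT (by decide) (fun c => Or.inl) (by omega)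
    omega
  obtain ⟨c, hcd, hct⟩ : {c | IsDifficult (G.induce (T : Set V)ᶜ) c ∧ Touches G T c}.Nonempty := by
    rw [← Set.ncard_pos]
    omega
  obtain ⟨D, I, hD, h | ⟨h, hclique⟩⟩ := exists_isAttached hct hcd
  · exact no_two _ _ h
  obtain ⟨x, hxc, s, hs, hsx⟩ := hct
  have hxD : (x : V) ∈ D := by
    rw [← Finset.mem_coe, hD]
    exact ⟨x, hxc, rfl⟩
  have hfinal : lambda (G.induce ((T ∪ D : Finset V) : Set V)ᶜ) + 1 ≤ lambda G := by
    simp only [hT, Finset.mem_insert, Finset.mem_singleton] at hs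
    rcases hs with rfl | rfl | rfl
    · exact absurd ((hvN x hsx).elim (by simp +contextual [hT]) (by simp +contextual [hT])) x.2
    · exact lambda_union_compl_lt (by rw [hT, Finset.pair_comm]) hwv.symm hvu huw.symm hTout h
        hclique hxD hsx
    · exact lambda_union_compl_lt hT hvu hwv.symm huw hTout h hclique hxD hsx
  have hkey := key D I 1 h
  have hfinal' : (lambda (G.induce ((T ∪ D : Finset V) : Set V)ᶜ) : ℝ) + 1 ≤ lambda G := by
    exact_mod_cast hfinal
  have hnn : (0 : ℝ) ≤ adjCount G (T ∪ D) (T ∪ D)ᶜ := Nat.cast_nonneg _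
  push_cast at hkey
  nlinarith [mul_nonneg hb.le hnn]

end Paper
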